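/- arXiv:1510.04677 — 2 statements merged into one kernel-verified Lean document; each statement's English description precedes it below -/
import Mathlib

section
/- Let k be a field and let φ : R → S be a surjective k-algebra homomorphism between commutative k-algebras R and S that are both smooth over k (i.e., finitely presented and formally smooth over k). Let I denote the kernel of φ. Then the S-module I/I² (where S = R/I acts in the natural way) is finitely generated and projective. -/
/-- If `S` is a formally smooth quotient of a formally smooth algebra `R` whose module of
differentials is finite, then the conormal module of `R → S` is finite projective. -/
theorem Algebra.FormallySmooth.finite_projective_cotangent_of_surjective
    {k R S : Type*} [CommRing k] [CommRing R] [CommRing S] [Algebra k R] [Algebra k S]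
    [Algebra R S] [IsScalarTower k R S] [Algebra.FormallySmooth k R] [Algebra.FormallySmooth k S]
    [Module.Finite R (KaehlerDifferential k R)]
    (h : Function.Surjective (algebraMap R S))
    [Module S (RingHom.ker (algebraMap R S)).Cotangent]
    [IsScalarTower R S (RingHom.ker (algebraMap R S)).Cotangent] :
    Module.Finite S (RingHom.ker (algebraMap R S)).Cotangent ∧
      Module.Projective S (RingHom.ker (algebraMap R S)).Cotangent := by
  obtain ⟨l, hl⟩ := (Algebra.FormallySmooth.iff_split_injection (R := k) h).mp inferInstance
  let r := l.extendScalarsOfSurjective h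
  let i := (KaehlerDifferential.kerCotangentToTensor k R S).extendScalarsOfSurjective h
  have hri : r ∘ₗ i = LinearMap.id := by
    ext x
    exact LinearMap.congr_fun hl x
  exact ⟨.of_surjective r fun x => ⟨i x, LinearMap.congr_fun hri x⟩, .of_split i r hri⟩

/-- Let `k` be a field and `φ : R → S` a surjective `k`-algebra
homomorphism between commutative `k`-algebras that are smooth over `k` (finitely
presented and formally smooth), with kernel `I`.  Then the `S`-module `I/I²`
(where `S = R/I` acts in the natural way, i.e. the action of `φ r` coincides with
the action of `r`) is finitely generated and projective. -/
theorem cotangent_finite_projective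
    {k R S : Type} [Field k] [CommRing R] [CommRing S] [Algebra k R] [Algebra k S]
    [Algebra.Smooth k R] [Algebra.Smooth k S]
    (φ : R →ₐ[k] S) (hφ : Function.Surjective φ)
    [Module S (RingHom.ker φ).Cotangent]
    (hcompat : ∀ (r : R) (x : (RingHom.ker φ).Cotangent), φ r • x = r • x) :
    Module.Finite S (RingHom.ker φ).Cotangent ∧
      Module.Projective S (RingHom.ker φ).Cotangent := by
  rename_i inst
  algebraize [φ.toRingHom]
  have : IsScalarTower k R S := .of_algebraMap_eq fun x => (φ.commutes x).symm
  let : Module S (RingHom.ker (algebraMap R S)).Cotangent := inst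
  have : IsScalarTower R S (RingHom.ker (algebraMap R S)).Cotangent := .of_algebraMap_smul hcompat
  exact Algebra.FormallySmooth.finite_projective_cotangent_of_surjective (k := k) (R := R) hφ
end

section
/- Let k be a field and let φ : R → S be a surjective k-algebra homomorphism between commutative k-algebras R and S that are both smooth over k, with kernel I; view S as an R-module via φ. Let F be an object of the (unbounded) derived category of R-modules such that every element of every cohomology module Hⁿ(F) is annihilated by some power of the ideal I. If Hom_{D(R)}(S, F⟦n⟧) = 0 for every integer n (where ⟦n⟧ denotes the n-th shift), then F is isomorphic to the zero object. -/
open CategoryTheory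

/-- `S`, viewed as an object of the category of `R`-modules via a ring
homomorphism `φ : R →+* S`. -/
noncomputable def restrictedModule {R S : Type} [CommRing R] [CommRing S]
    (φ : R →+* S) : ModuleCat R :=
  letI : Module R S := Module.compHom S φ
  ModuleCat.of R S

section DerivedCategoryLemmas

open Limits DerivedCategory Pretriangulated ZeroObject

universe t w v u

namespace DerivedCategory
variable {C : Type u} [Category.{v} C] [Abelian C]

lemma acyclic_of_isColimit_cofan [HasCoproducts.{0} C] [AB4OfSize.{0} C] {ι : Type}
    {X : ι → CochainComplex C ℤ} {c : Cofan X} (hc : IsColimit c) (hX : ∀ i, (X i).Acyclic) :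
    c.pt.Acyclic := by
  intro n
  let D := Discrete.functor X
  let ev (i : ℤ) := HomologicalComplex.eval C (.up ℤ) i
  let S : ShortComplex (Discrete ι ⥤ C) :=
    { X₁ := D ⋙ ev ((ComplexShape.up ℤ).prev n)
      X₂ := D ⋙ ev n
      X₃ := D ⋙ ev ((ComplexShape.up ℤ).next n)
      f := { app j := (D.obj j).d _ _, naturality _ _ f := (D.map f).comm _ _ }
      g := { app j := (D.obj j).d _ _, naturality _ _ f := (D.map f).comm _ _ }
      zero := by ext j; exact (D.obj j).d_comp_d _ _ _ }
  have hS : S.Exact := by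
    rw [ShortComplex.exact_iff_isZero_homology, Functor.isZero_iff]
    intro j
    exact (hX j.as n).isZero_homology.of_iso (S.mapHomologyIso ((evaluation _ _).obj j)).symm
  exact colim.exact_mapShortComplex hS (isColimitOfPreserves (ev _) hc)
    (isColimitOfPreserves (ev _) hc) (isColimitOfPreserves (ev _) hc)
    (c.pt.d _ _) (c.pt.d _ _) (fun j ↦ (c.ι.app j).comm _ _) (fun j ↦ (c.ι.app j).comm _ _)

variable [HasDerivedCategory.{w} C]

lemma isZero_of_isZero_homology {X : DerivedCategory C}
    (h : ∀ n, IsZero ((homologyFunctor C n).obj X)) : IsZero X := by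
  have : IsIso (0 : X ⟶ 0) := by
    rw [isIso_iff]
    intro n
    exact ⟨0, (h n).eq_of_src _ _,
      (((homologyFunctor C n).map_isZero (isZero_zero _))).eq_of_src _ _⟩
  exact (isZero_zero _).of_iso (asIso (0 : X ⟶ 0))

lemma Q_obj_isZero_iff (X : CochainComplex C ℤ) : IsZero (Q.obj X) ↔ X.Acyclic := by
  constructor
  · intro h n
    rw [HomologicalComplex.exactAt_iff_isZero_homology]
    exact ((homologyFunctor C n).map_isZero h).of_iso ((homologyFunctorFactors C n).app X).symm
  · intro h
    exact isZero_of_isZero_homology fun n ↦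
      (h n).isZero_homology.of_iso ((homologyFunctorFactors C n).app X)

lemma exists_fac_acyclic_of_Q_map_eq_zero {X Y : CochainComplex C ℤ} (g : X ⟶ Y)
    (hg : Q.map g = 0) :
    ∃ (Z : CochainComplex C ℤ) (u : X ⟶ Z) (v : Z ⟶ Y), Z.Acyclic ∧ u ≫ v = g := by
  have h : Qh.map ((HomotopyCategory.quotient C (.up ℤ)).map g) =
      Qh.map ((HomotopyCategory.quotient C (.up ℤ)).map 0) := by
    change Q.map g = Q.map 0
    rw [hg, Functor.map_zero]
  rw [MorphismProperty.map_eq_iff_precomp Qh (HomotopyCategory.quasiIso C _)] at h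
  obtain ⟨X', s, hs, h⟩ := h
  obtain ⟨X', rfl⟩ := HomotopyCategory.quotient_obj_surjective X'
  obtain ⟨s, rfl⟩ := (HomotopyCategory.quotient _ _).map_surjective s
  rw [← Functor.map_comp, Functor.map_zero, comp_zero] at h
  have H : Homotopy (s ≫ g) 0 := HomotopyCategory.homotopyOfEq _ _ (by rw [h, Functor.map_zero])
  obtain ⟨α, hα⟩ := CochainComplex.HomComplex.Cochain.equivHomotopy _ _ H
  rw [HomotopyCategory.quotient_map_mem_quasiIso_iff] at hs
  refine ⟨CochainComplex.mappingCone s, CochainComplex.mappingCone.inr s,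
    CochainComplex.mappingCone.desc s α g (by simp [hα]), ?_, by simp⟩
  rw [← Q_obj_isZero_iff]
  exact Triangle.isZero₃_of_isIso₁ _ (mappingCone_triangle_distinguished s)
    ((isIso_Q_map_iff_quasiIso C s).2 hs)

/-- The objects `X` with `Hom(X, F⟦n⟧) = 0` for all `n : ℤ`. -/
def shiftLeftOrthogonal (F : DerivedCategory C) : ObjectProperty (DerivedCategory C) :=
  ((ObjectProperty.singleton F).shiftClosure ℤ).leftOrthogonal

lemma shiftLeftOrthogonal_iff (F X : DerivedCategory C) :
    shiftLeftOrthogonal F X ↔ ∀ (n : ℤ) (f : X ⟶ F⟦n⟧), f = 0 := by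
  constructor
  · intro h n f
    exact h f ⟨F, n, Iso.refl _, by simp⟩
  · rintro h Y f ⟨Z, n, e, hZ⟩
    obtain rfl : F = Z := by simpa using hZ
    rw [← cancel_mono e.hom, zero_comp]
    exact h n _

instance (F : DerivedCategory C) : (shiftLeftOrthogonal F).IsTriangulated := by
  unfold shiftLeftOrthogonal; infer_instance
instance (F : DerivedCategory C) : (shiftLeftOrthogonal F).IsClosedUnderIsomorphisms := by
  unfold shiftLeftOrthogonal; infer_instance

lemma shiftLeftOrthogonal_of_retract {F X Y : DerivedCategory C} (r : Retract X Y)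
    (hY : shiftLeftOrthogonal F Y) : shiftLeftOrthogonal F X := by
  rw [shiftLeftOrthogonal_iff] at hY ⊢
  intro n f
  rw [← Category.id_comp f, ← r.retract, Category.assoc, hY n (r.r ≫ f), comp_zero]

lemma shiftLeftOrthogonal_singleFunctor {F : DerivedCategory C} {M : C}
    (h : shiftLeftOrthogonal F ((singleFunctor C 0).obj M)) (n : ℤ) :
    shiftLeftOrthogonal F (Q.obj ((HomologicalComplex.single C (.up ℤ) n).obj M)) := by
  have : (singleFunctor C n).obj M ≅ ((singleFunctor C 0).obj M)⟦-n⟧ :=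
    ((singleFunctors C).shiftIso (-n) n 0 (by simp)).symm.app M
  exact (shiftLeftOrthogonal F).prop_of_iso ((singleFunctorIsoCompQ C n).app M) (
    (shiftLeftOrthogonal F).prop_of_iso this.symm ((shiftLeftOrthogonal F).le_shift _ _ h))

/-- The left orthogonal of the shifts of `F` is closed under coproducts, computed on complexes. -/
lemma shiftLeftOrthogonal_of_isColimit_cofan [HasCoproducts.{0} C] [AB4OfSize.{0} C]
    {F : DerivedCategory C} {ι : Type} {X : ι → CochainComplex C ℤ} {c : Cofan X}
    (hc : IsColimit c) (hX : ∀ i, shiftLeftOrthogonal F (Q.obj (X i))) :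
    shiftLeftOrthogonal F (Q.obj c.pt) := by
  rw [shiftLeftOrthogonal_iff]
  intro n f
  let Y := Q.objPreimage (F⟦n⟧)
  let e : Q.obj Y ≅ F⟦n⟧ := Q.objObjPreimageIso _
  obtain ⟨Y', g, s, _, hg⟩ := left_fac (f ≫ e.inv)
  have h (i : ι) : Q.map (c.inj i ≫ g) = 0 := by
    have hg₁ : Q.map g = (f ≫ e.inv) ≫ Q.map s := by rw [hg]; simp
    rw [Q.map_comp, hg₁, ← Category.assoc, ← Category.assoc,
      (shiftLeftOrthogonal_iff _ _).1 (hX i) n (Q.map (c.inj i) ≫ f), zero_comp, zero_comp]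
  choose Z u v hZ huv using fun i ↦ exists_fac_acyclic_of_Q_map_eq_zero _ (h i)
  have hg' : g = Cofan.IsColimit.desc hc (fun i ↦ u i ≫ Sigma.ι Z i) ≫ Sigma.desc v :=
    Cofan.IsColimit.hom_ext hc _ _ (by simp [huv])
  have hZ' : IsZero (Q.obj (∐ Z)) :=
    (Q_obj_isZero_iff _).2 (acyclic_of_isColimit_cofan (coproductIsCoproduct Z) hZ)
  rw [← cancel_mono e.inv, hg, hg', Q.map_comp, hZ'.eq_of_tgt (Q.map _) 0]
  simp

end DerivedCategory

lemma smul_id_eq_zero_of_mono {R D : Type*} [Semiring R] [Category* D] [Preadditive D] [Linear R D]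
    {r : R} {X Y : D} (i : X ⟶ Y) [Mono i] (h : i ≫ (r • 𝟙 Y) = 0) : r • 𝟙 X = 0 := by
  rw [← cancel_mono i, Linear.smul_comp, Category.id_comp, zero_comp, ← h, Linear.comp_smul,
    Category.comp_id]

lemma smul_id_eq_zero_of_epi {R D : Type*} [Semiring R] [Category* D] [Preadditive D] [Linear R D]
    {r : R} {X Y : D} (p : X ⟶ Y) [Epi p] (h : (r • 𝟙 X) ≫ p = 0) : r • 𝟙 Y = 0 := by
  rw [← cancel_epi p, Linear.comp_smul, Category.comp_id, comp_zero, ← h, Linear.smul_comp,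
    Category.id_comp]

lemma coyoneda_shift_exact₃ {D : Type*} [Category* D] [Preadditive D] [HasZeroObject D]
    [HasShift D ℤ] [∀ n : ℤ, (shiftFunctor D n).Additive] [Pretriangulated D] {X₁ X₂ X₃ : D}
    {a : X₁ ⟶ X₂} {b : X₂ ⟶ X₃} {c : X₃ ⟶ X₁⟦(1 : ℤ)⟧} (hT : Triangle.mk a b c ∈ distTriang D)
    {X : D} {n : ℤ} (f : X ⟶ X₃⟦n⟧) (hf : f ≫ c⟦n⟧' = 0) :
    ∃ g : X ⟶ X₂⟦n⟧, f = g ≫ b⟦n⟧' := by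
  obtain ⟨g, hg⟩ : ∃ g : X ⟶ X₂⟦n⟧, f = g ≫ (n.negOnePow • b⟦n⟧') :=
    Triangle.coyoneda_exact₃ _ (Triangle.shift_distinguished _ hT n) f (by
      change f ≫ (n.negOnePow • (c⟦n⟧' ≫ (shiftFunctorComm D 1 n).hom.app X₁)) = 0
      rw [Linear.comp_units_smul, reassoc_of% hf, zero_comp, smul_zero])
  exact ⟨n.negOnePow • g, by rw [hg, Linear.comp_units_smul, Linear.units_smul_comp]⟩

namespace DerivedCategory
variable {C : Type u} [Category.{v} C] [Abelian C] [HasDerivedCategory.{w} C]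

lemma isZero_of_shiftLeftOrthogonal_singleFunctor {F : DerivedCategory C}
    (h : ∀ M : C, shiftLeftOrthogonal F ((singleFunctor C 0).obj M)) : IsZero F := by
  let K := Q.objPreimage F
  let e : Q.obj K ≅ F := Q.objObjPreimageIso F
  refine ((Q_obj_isZero_iff K).2 fun n ↦ ?_).of_iso e.symm
  rw [HomologicalComplex.exactAt_iff_isZero_homology]
  let m : (HomologicalComplex.single C (.up ℤ) n).obj (K.cycles n) ⟶ K :=
    HomologicalComplex.mkHomFromSingle (K.iCycles n) (fun k _ ↦ K.iCycles_d n k)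
  have hQm : Q.map m = 0 := by
    let e' : Q.obj K ≅ F⟦(0 : ℤ)⟧ := e ≪≫ ((shiftFunctorZero _ ℤ).app F).symm
    rw [← cancel_mono e'.hom, zero_comp]
    exact (shiftLeftOrthogonal_iff _ _).1 (shiftLeftOrthogonal_singleFunctor (h _) n) 0 _
  have hm : HomologicalComplex.homologyMap m n = 0 := by
    have := homologyFunctorFactors_hom_naturality m n
    rw [hQm, Functor.map_zero, zero_comp] at this
    exact ((cancel_epi ((homologyFunctorFactors C n).app _).hom).1
      (this.symm.trans comp_zero.symm) :)
  have hπ : K.homologyπ n = 0 := by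
    have h1 : (HomologicalComplex.singleObjCyclesSelfIso (.up ℤ) n (K.cycles n)).inv ≫
        HomologicalComplex.cyclesMap m n = 𝟙 _ := by
      rw [← cancel_mono (K.iCycles n), Category.assoc, HomologicalComplex.cyclesMap_i]
      simp [m]
    rw [← Category.id_comp (K.homologyπ n), ← h1, Category.assoc,
      ← HomologicalComplex.homologyπ_naturality, hm, comp_zero, comp_zero]
  rw [IsZero.iff_id_eq_zero, ← cancel_epi (K.homologyπ n), hπ, zero_comp, zero_comp]

lemma trW_singleFunctor_map {F : DerivedCategory C} {M : C} (g : M ⟶ M)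
    (h₁ : shiftLeftOrthogonal F ((singleFunctor C 0).obj (kernel (Abelian.factorThruImage g))))
    (h₂ : shiftLeftOrthogonal F ((singleFunctor C 0).obj (cokernel (Abelian.image.ι g)))) :
    (shiftLeftOrthogonal F).trW ((singleFunctor C 0).map g) := by
  have hp : (ShortComplex.mk _ _ (kernel.condition (Abelian.factorThruImage g))).ShortExact :=
    { exact := ShortComplex.exact_kernel _ }
  have hi : (ShortComplex.mk _ _ (cokernel.condition (Abelian.image.ι g))).ShortExact :=
    { exact := ShortComplex.exact_cokernel _ }
  have := MorphismProperty.comp_mem _ _ _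
    (ObjectProperty.trW.mk' _ hp.singleTriangle_distinguished h₁)
    (ObjectProperty.trW.mk _ hi.singleTriangle_distinguished h₂)
  rw [← Abelian.image.fac g, Functor.map_comp]
  exact this

section Linear

variable {R : Type t} [CommRing R] [Linear R C]

instance (n : ℤ) : (homologyFunctor C n).Linear R := by
  have : (HomologicalComplex.homologyFunctor C (.up ℤ) n).Linear R :=
    ⟨fun f r ↦ ShortComplex.homologyMap_smul ((HomologicalComplex.shortComplexFunctor _ _ n).map f) r⟩
  have : Localization.Lifting Q (HomologicalComplex.quasiIso C (.up ℤ))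
      (HomologicalComplex.homologyFunctor C (.up ℤ) n) (homologyFunctor C n) :=
    ⟨homologyFunctorFactors C n⟩
  rwa [← Localization.functor_linear_iff (R := R) Q (HomologicalComplex.quasiIso C (.up ℤ))
    (HomologicalComplex.homologyFunctor C (.up ℤ) n) (homologyFunctor C n)]

lemma shiftLeftOrthogonal_of_distTriang {F G : DerivedCategory C} {r : R}
    {a : F ⟶ G} {b : G ⟶ F⟦(1 : ℤ)⟧} (hT : Triangle.mk (r • 𝟙 F) a b ∈ distTriang _)
    {X : DerivedCategory C} (hX : (shiftLeftOrthogonal F).trW (r • 𝟙 X)) :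
    shiftLeftOrthogonal G X := by
  have hF (n : ℤ) : Function.Bijective fun (g : X ⟶ F⟦n⟧) ↦ r • g := by
    have : (shiftLeftOrthogonal F).rightOrthogonal (F⟦n⟧) := fun Y f hY ↦
      (shiftLeftOrthogonal_iff _ _).1 hY n f
    rw [← ObjectProperty.isLocal_trW] at this
    simpa using this _ hX
  rw [shiftLeftOrthogonal_iff]
  intro n h
  have h0 : h ≫ b⟦n⟧' = 0 := by
    let e : (F⟦(1 : ℤ)⟧)⟦n⟧ ≅ F⟦1 + n⟧ := ((shiftFunctorAdd _ 1 n).app F).symm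
    have hb : r • b = 0 := by
      have h : b ≫ (r • 𝟙 F)⟦(1 : ℤ)⟧' = 0 := comp_distTriang_mor_zero₃₁ _ hT
      rwa [Functor.map_smul, CategoryTheory.Functor.map_id, Linear.comp_smul, Category.comp_id] at h
    rw [← cancel_mono e.hom, zero_comp]
    apply (hF _).1
    dsimp only
    rw [smul_zero, ← Linear.smul_comp, ← Linear.comp_smul, ← Functor.map_smul, hb, Functor.map_zero,
      comp_zero, zero_comp]
  obtain ⟨h', rfl⟩ := coyoneda_shift_exact₃ hT h h0
  obtain ⟨h'', rfl⟩ := (hF n).2 h'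
  have ha : r • a = 0 := by
    have h : (r • 𝟙 F) ≫ a = 0 := comp_distTriang_mor_zero₁₂ _ hT
    rwa [Linear.smul_comp, Category.id_comp] at h
  dsimp only
  rw [Linear.smul_comp, ← Linear.comp_smul, ← Functor.map_smul, ha, Functor.map_zero, comp_zero]

lemma shiftLeftOrthogonal_singleFunctor_of_distTriang {F G : DerivedCategory C} {r : R}
    {a : F ⟶ G} {b : G ⟶ F⟦(1 : ℤ)⟧} (hT : Triangle.mk (r • 𝟙 F) a b ∈ distTriang _) {s : Set R}
    (h : ∀ M : C, (∀ x ∈ insert r s, x • 𝟙 M = 0) →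
      shiftLeftOrthogonal F ((singleFunctor C 0).obj M)) {M : C} (hM : ∀ x ∈ s, x • 𝟙 M = 0) :
    shiftLeftOrthogonal G ((singleFunctor C 0).obj M) := by
  apply shiftLeftOrthogonal_of_distTriang hT
  rw [← CategoryTheory.Functor.map_id, ← Functor.map_smul]
  apply trW_singleFunctor_map
  · refine h _ (Set.forall_mem_insert.2 ⟨?_, fun x hx ↦ ?_⟩)
    · refine smul_id_eq_zero_of_mono (kernel.ι (Abelian.factorThruImage (r • 𝟙 M))) ?_
      refine (congrArg (kernel.ι (Abelian.factorThruImage (r • 𝟙 M)) ≫ ·)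
        (Abelian.image.fac (r • 𝟙 M)).symm).trans ?_
      rw [kernel.condition_assoc, zero_comp]
    · exact smul_id_eq_zero_of_mono (kernel.ι _) (by rw [hM x hx, comp_zero])
  · refine h _ (Set.forall_mem_insert.2 ⟨?_, fun x hx ↦ ?_⟩)
    · refine smul_id_eq_zero_of_epi (cokernel.π (Abelian.image.ι (r • 𝟙 M))) ?_
      refine (congrArg (· ≫ cokernel.π (Abelian.image.ι (r • 𝟙 M)))
        (Abelian.image.fac (r • 𝟙 M)).symm).trans ?_
      rw [Category.assoc, cokernel.condition, comp_zero]
    · exact smul_id_eq_zero_of_epi (cokernel.π _) (by rw [hM x hx, zero_comp])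

end Linear

variable {R : Type u} [CommRing R] [HasDerivedCategory.{w} (ModuleCat.{v} R)]

lemma exists_pow_smul_eq_zero_of_distTriang {F G : DerivedCategory (ModuleCat.{v} R)}
    {f : F ⟶ F} {a : F ⟶ G} {b : G ⟶ F⟦(1 : ℤ)⟧} (hT : Triangle.mk f a b ∈ distTriang _) {r : R}
    (h : ∀ (n : ℤ) (x : (homologyFunctor (ModuleCat.{v} R) n).obj F), ∃ m : ℕ, r ^ m • x = 0)
    (n : ℤ) (x : (homologyFunctor (ModuleCat.{v} R) n).obj G) : ∃ m : ℕ, r ^ m • x = 0 := by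
  have h₂ := HomologySequence.exact₂ _ hT n
  have h₃ := HomologySequence.exact₃ _ hT n (n + 1) rfl
  rw [ShortComplex.moduleCat_exact_iff] at h₂ h₃
  obtain ⟨m, hm⟩ := h (n + 1) ((HomologySequence.δ (Triangle.mk f a b) n (n + 1) rfl).hom x)
  obtain ⟨y, hy⟩ := h₃ (r ^ m • x) (by
    exact (map_smul (HomologySequence.δ (Triangle.mk f a b) n (n + 1) rfl).hom _ _).trans hm)
  obtain ⟨m', hm'⟩ := h n y
  refine ⟨m' + m, ?_⟩
  rw [pow_add, mul_smul, ← hy]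
  refine (map_smul ((homologyFunctor (ModuleCat.{v} R) n).map a).hom _ _).symm.trans ?_
  exact (congrArg _ hm').trans (map_zero _)

/-- If the cohomology of `F` is torsion with respect to every `r ∈ s`, and there is no nonzero
morphism to a shift of `F` from a module that is killed by `s`, then `F` is zero. -/
theorem isZero_of_shiftLeftOrthogonal_of_torsion (s : Finset R)
    {F : DerivedCategory (ModuleCat.{v} R)}
    (htors : ∀ r ∈ s, ∀ (n : ℤ) (x : (homologyFunctor (ModuleCat.{v} R) n).obj F),
      ∃ m : ℕ, r ^ m • x = 0)
    (h : ∀ M : ModuleCat.{v} R, (∀ r ∈ s, r • 𝟙 M = 0) →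
      shiftLeftOrthogonal F ((singleFunctor (ModuleCat.{v} R) 0).obj M)) : IsZero F := by
  classical
  induction s using Finset.induction_on generalizing F with
  | empty => exact isZero_of_shiftLeftOrthogonal_singleFunctor (by simpa using h)
  | insert r s _ ih =>
    obtain ⟨G, a, b, hT⟩ := distinguished_cocone_triangle (r • 𝟙 F)
    have hG : IsZero G := ih
      (fun x hx ↦ exists_pow_smul_eq_zero_of_distTriang hT (htors x (Finset.mem_insert_of_mem hx)))
      (fun M hM ↦ shiftLeftOrthogonal_singleFunctor_of_distTriang hT (s := s)
        (by simpa using h) hM)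
    have : IsIso (r • 𝟙 F) := (Triangle.isZero₃_iff_isIso₁ _ hT).1 hG
    refine isZero_of_isZero_homology fun n ↦ ?_
    have hinj : Function.Injective fun x : (homologyFunctor (ModuleCat.{v} R) n).obj F ↦ r • x := by
      have := (ConcreteCategory.bijective_of_isIso
        ((homologyFunctor (ModuleCat.{v} R) n).map (r • 𝟙 F))).1
      rw [Functor.map_smul, CategoryTheory.Functor.map_id] at this
      exact this
    rw [ModuleCat.isZero_iff_subsingleton]
    refine subsingleton_of_forall_eq 0 fun x ↦ ?_
    obtain ⟨m, hm⟩ := htors r (Finset.mem_insert_self _ _) n x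
    induction m with
    | zero => simpa using hm
    | succ m ihm =>
      refine ihm (hinj ?_)
      dsimp only
      rw [← mul_smul, ← pow_succ', hm, smul_zero]

end DerivedCategory

namespace ModuleCat
open scoped DirectSum

variable {R : Type u} [Ring R]

lemma exists_projections_of_isColimit_cofan {ι : Type} {A : ι → ModuleCat.{v} R}
    {c : Cofan A} (hc : IsColimit c) : ∃ p : ∀ i, c.pt ⟶ A i,
      (∀ i, c.inj i ≫ p i = 𝟙 _) ∧ (∀ i j, j ≠ i → c.inj j ≫ p i = 0) ∧
      ∀ x, (∀ i, p i x = 0) → x = 0 := by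
  classical
  let e : c.pt ≅ ModuleCat.of R (⨁ i, A i) :=
    hc.coconePointUniqueUpToIso (coproductCoconeIsColimit A)
  have he (i : ι) : c.inj i ≫ e.hom = ofHom (DirectSum.lof R ι (fun i ↦ A i) i) :=
    hc.comp_coconePointUniqueUpToIso_hom (coproductCoconeIsColimit A) ⟨i⟩
  refine ⟨fun i ↦ e.hom ≫ ofHom (DirectSum.component R ι (fun i ↦ A i) i), fun i ↦ ?_,
    fun i j h ↦ ?_, fun x hx ↦ ?_⟩
  · rw [← Category.assoc, he]
    ext a
    simp
  · rw [← Category.assoc, he]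
    ext a
    simp [DirectSum.component.of, h]
  · have : e.hom x = 0 := DFinsupp.ext fun i ↦ hx i
    have h := congr($(e.hom_inv_id) x)
    exact h.symm.trans ((congrArg e.inv this).trans (map_zero e.inv.hom))

lemma mem_of_isColimit_cofan {ι : Type} {A : ι → ModuleCat.{v} R}
    {c : Cofan A} (hc : IsColimit c) (U : Submodule R c.pt)
    (h : ∀ i (a : A i), c.inj i a ∈ U) (x : c.pt) : x ∈ U := by
  have : ModuleCat.ofHom U.mkQ = 0 := by
    refine Cofan.IsColimit.hom_ext hc _ _ fun i ↦ ?_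
    ext a
    simpa using h i a
  simpa using congr($this x)

section telescope

variable {A : ℕ → ModuleCat.{v} R} {M : ModuleCat.{v} R} (j : ∀ n, A n ⟶ A (n + 1))
  (ι : ∀ n, A n ⟶ M)

/-- The telescope short exact sequence `0 → ⨁ A n → ⨁ A n → M → 0` of an increasing exhaustive
filtration of a module `M`. -/
lemma shortExact_telescope (hinj : ∀ n, Function.Injective (ι n)) (hsurj : ∀ m, ∃ n a, ι n a = m)
    {c : Cofan A} (hc : IsColimit c) (f : c.pt ⟶ c.pt) (g : c.pt ⟶ M)
    (hf : ∀ n, c.inj n ≫ f = c.inj n - j n ≫ c.inj (n + 1)) (hg : ∀ n, c.inj n ≫ g = ι n)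
    (zero : f ≫ g = 0) :
    (ShortComplex.mk f g zero).ShortExact := by
  have key : ∀ x : c.pt, ∃ N a, ∃ y, x = f y + c.inj N a := by
    intro x
    refine mem_of_isColimit_cofan hc
      { carrier := {x | ∃ N a, ∃ y, x = f y + c.inj N a}
        zero_mem' := ⟨0, 0, 0, by simp⟩
        add_mem' := ?_
        smul_mem' := ?_ } (fun i a ↦ ⟨i, a, 0, by simp⟩) x
    · have step (N n : ℕ) (h : N ≤ n) (a : A N) : ∃ b, ∃ y, c.inj N a = f y + c.inj n b := by
        induction n, h using Nat.le_induction with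
        | base => exact ⟨a, 0, by simp⟩
        | succ n _ ih =>
          obtain ⟨b, y, h⟩ := ih
          have : f (c.inj n b) = c.inj n b - c.inj (n + 1) (j n b) := congr($(hf n) b)
          exact ⟨j n b, y + c.inj n b, by rw [h, map_add, this]; abel⟩
      rintro _ _ ⟨N, a, y, rfl⟩ ⟨N', a', y', rfl⟩
      obtain ⟨b, z, h⟩ := step N (max N N') (le_max_left _ _) a
      obtain ⟨b', z', h'⟩ := step N' (max N N') (le_max_right _ _) a'
      exact ⟨_, b + b', y + y' + z + z', by rw [h, h']; simp only [map_add]; abel⟩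
    · rintro r _ ⟨N, a, y, rfl⟩
      exact ⟨N, r • a, r • y, by simp⟩
  refine .mk' ?_ ?_ ?_
  · rw [ShortComplex.moduleCat_exact_iff]
    intro x hx
    obtain ⟨N, a, y, rfl⟩ := key x
    refine ⟨y, ?_⟩
    have h₁ : g (f y) = 0 := by simpa using congr($zero y)
    have h₂ : g (c.inj N a) = ι N a := congr($(hg N) a)
    have h₃ : a = 0 := hinj N (by rw [← h₂]; simpa [h₁] using hx)
    simp [h₃]
  · rw [ModuleCat.mono_iff_injective]
    obtain ⟨p, hp₁, hp₂, hp⟩ := exists_projections_of_isColimit_cofan hc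
    refine (injective_iff_map_eq_zero f.hom).2 fun x hx ↦ hp x fun n ↦ ?_
    have hx : f x = 0 := hx
    induction n with
    | zero =>
      have : f ≫ p 0 = p 0 := by
        refine Cofan.IsColimit.hom_ext hc _ _ fun i ↦ ?_
        rw [← Category.assoc, hf, Preadditive.sub_comp, Category.assoc, hp₂ 0 (i + 1) (by simp)]
        simp
      simpa [hx] using congr($this x).symm
    | succ n ih =>
      have : f ≫ p (n + 1) = p (n + 1) - p n ≫ j n := by
        refine Cofan.IsColimit.hom_ext hc _ _ fun i ↦ ?_
        rw [← Category.assoc, hf, Preadditive.sub_comp, Category.assoc, Preadditive.comp_sub,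
          ← Category.assoc (c.inj i)]
        by_cases h : i = n
        · subst h
          simp [hp₁]
        · simp [hp₂ (n + 1) (i + 1) (by simpa using h), hp₂ n i h]
      simpa [hx, ih] using congr($this x).symm
  · rw [ModuleCat.epi_iff_surjective]
    intro m
    obtain ⟨n, a, rfl⟩ := hsurj m
    exact ⟨c.inj n a, congr($(hg n) a)⟩

end telescope
end ModuleCat

namespace ModuleCat

variable {R : Type u} [Ring R]

/-- The subcomplex of a complex of modules `P` which is given by `P.X i` in degrees `i ≥ p` and
by zero in degrees `i < p`. -/
def stupidTruncGE (P : CochainComplex (ModuleCat.{v} R) ℤ) (p : ℤ) :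
    CochainComplex (ModuleCat.{v} R) ℤ where
  X i := ModuleCat.of R (if p ≤ i then ⊤ else ⊥ : Submodule R (P.X i))
  d i j := ofHom ((P.d i j).hom.restrict (by
    intro x hx
    by_cases hij : i + 1 = j
    · by_cases hi : p ≤ i
      · rw [if_pos (by lia)]
        trivial
      · rw [if_neg hi] at hx
        simp [(Submodule.mem_bot R).1 hx]
    · simp [P.shape i j hij]))
  shape i j hij := by
    ext x
    simp [P.shape i j hij]
  d_comp_d' i j k _ _ := by
    ext x
    exact congr($(P.d_comp_d i j k) x.1)

lemma ite_top_bot_le {α : Type*} [Lattice α] [BoundedOrder α] {a b : Prop} [Decidable a]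
    [Decidable b] (h : a → b) : (if a then ⊤ else ⊥ : α) ≤ if b then ⊤ else ⊥ := by
  split_ifs <;> simp_all

/-- The inclusion of one truncation in another one. -/
def stupidTruncGEMap (P : CochainComplex (ModuleCat.{v} R) ℤ) {p q : ℤ} (h : p ≤ q) :
    stupidTruncGE P q ⟶ stupidTruncGE P p where
  f i := ofHom (Submodule.inclusion (ite_top_bot_le (by lia)))
  comm' _ _ _ := rfl

/-- The inclusion of a truncation in the complex. -/
def ιStupidTruncGE (P : CochainComplex (ModuleCat.{v} R) ℤ) (p : ℤ) : stupidTruncGE P p ⟶ P where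
  f _ := ofHom (Submodule.subtype _)
  comm' _ _ _ := rfl

lemma isZero_stupidTruncGE_X (P : CochainComplex (ModuleCat.{v} R) ℤ) {p i : ℤ}
    (h : i < p ∨ IsZero (P.X i)) : IsZero ((stupidTruncGE P p).X i) := by
  rw [ModuleCat.isZero_iff_subsingleton]
  change Subsingleton (if p ≤ i then ⊤ else ⊥ : Submodule R (P.X i))
  obtain h | h := h
  · rw [if_neg (by lia)]
    infer_instance
  · rw [ModuleCat.isZero_iff_subsingleton] at h
    infer_instance

/-- The projection of a truncation to its lowest degree term. -/
noncomputable def stupidTruncGEToSingle (P : CochainComplex (ModuleCat.{v} R) ℤ) (p : ℤ) :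
    stupidTruncGE P p ⟶ (HomologicalComplex.single _ (.up ℤ) p).obj (P.X p) :=
  HomologicalComplex.mkHomToSingle ((ιStupidTruncGE P p).f p) fun i hi ↦
    (isZero_stupidTruncGE_X P (.inl (by simp at hi; lia))).eq_of_src _ _

lemma bijective_stupidTruncGEToSingle_f (P : CochainComplex (ModuleCat.{v} R) ℤ) (p : ℤ) :
    Function.Bijective ((stupidTruncGEToSingle P p).f p) := by
  have h : Function.Bijective ((ιStupidTruncGE P p).f p) :=
    ⟨Submodule.subtype_injective _, fun x ↦ ⟨⟨x, by simp⟩, rfl⟩⟩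
  rw [← ConcreteCategory.isIso_iff_bijective] at h ⊢
  rw [stupidTruncGEToSingle, HomologicalComplex.mkHomToSingle_f]
  infer_instance

lemma stupidTruncGE_comp (P : CochainComplex (ModuleCat.{v} R) ℤ) (p : ℤ) :
    stupidTruncGEMap P (Int.le_add_one le_rfl) ≫ stupidTruncGEToSingle P p = 0 := by
  refine HomologicalComplex.hom_ext _ _ fun i ↦ ?_
  by_cases hi : i = p
  · subst hi
    exact (isZero_stupidTruncGE_X P (.inl (by lia))).eq_of_src _ _
  · exact (HomologicalComplex.isZero_single_obj_X _ _ _ _ hi).eq_of_tgt _ _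

lemma shortExact_stupidTruncGE (P : CochainComplex (ModuleCat.{v} R) ℤ) (p : ℤ) :
    (ShortComplex.mk _ _ (stupidTruncGE_comp P p)).ShortExact := by
  refine HomologicalComplex.shortExact_of_degreewise_shortExact _ fun i ↦ ?_
  refine .mk' ?_ ?_ ?_
  · rw [ShortComplex.moduleCat_exact_iff]
    intro x hx
    by_cases hi : i = p
    · subst hi
      exact ⟨0, (bijective_stupidTruncGEToSingle_f P i).1 ((map_zero _).trans hx.symm)⟩
    · have h : (if p ≤ i then ⊤ else ⊥ : Submodule R (P.X i)) ≤ if p + 1 ≤ i then ⊤ else ⊥ :=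
        ite_top_bot_le (by lia)
      exact ⟨⟨x.1, h x.2⟩, rfl⟩
  · exact (ModuleCat.mono_iff_injective _).2 (Submodule.inclusion_injective (ite_top_bot_le (by lia)))
  · by_cases hi : i = p
    · subst hi
      exact (ModuleCat.epi_iff_surjective _).2 (bijective_stupidTruncGEToSingle_f P i).2
    · exact (HomologicalComplex.isZero_single_obj_X (.up ℤ) _ _ _ hi).epi _

end ModuleCat

namespace DerivedCategory

variable {R : Type} [Ring R] [HasDerivedCategory.{w} (ModuleCat.{0} R)]
  {F : DerivedCategory (ModuleCat.{0} R)}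

lemma shiftLeftOrthogonal_of_telescope {A : ℕ → CochainComplex (ModuleCat.{0} R) ℤ}
    {P : CochainComplex (ModuleCat.{0} R) ℤ} (j : ∀ n, A n ⟶ A (n + 1)) (ι : ∀ n, A n ⟶ P)
    (comm : ∀ n, j n ≫ ι (n + 1) = ι n) (hinj : ∀ n i, Function.Injective ((ι n).f i))
    (hsurj : ∀ i m, ∃ n a, (ι n).f i a = m) (hA : ∀ n, shiftLeftOrthogonal F (Q.obj (A n))) :
    shiftLeftOrthogonal F (Q.obj P) := by
  let c : Cofan A := Cofan.mk _ (Sigma.ι A)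
  let hc : IsColimit c := coproductIsCoproduct A
  let f : c.pt ⟶ c.pt := Cofan.IsColimit.desc hc fun n ↦ c.inj n - j n ≫ c.inj (n + 1)
  let g : c.pt ⟶ P := Cofan.IsColimit.desc hc ι
  have hf (n) : c.inj n ≫ f = c.inj n - j n ≫ c.inj (n + 1) := by simp [f]
  have hg (n) : c.inj n ≫ g = ι n := by simp [g]
  have zero : f ≫ g = 0 := Cofan.IsColimit.hom_ext hc _ _ fun n ↦ by
    rw [← Category.assoc, hf, Preadditive.sub_comp, Category.assoc, hg, hg, comm, sub_self,
      comp_zero]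
  have hS : (ShortComplex.mk f g zero).ShortExact := by
    refine HomologicalComplex.shortExact_of_degreewise_shortExact _ fun i ↦ ?_
    refine ModuleCat.shortExact_telescope (fun n ↦ (j n).f i) (fun n ↦ (ι n).f i)
      (fun n ↦ hinj n i) (hsurj i)
      (isColimitCofanMkObjOfIsColimit (HomologicalComplex.eval _ (.up ℤ) i) _ _ hc) _ _
      (fun n ↦ congr($(hf n).f i)) (fun n ↦ congr($(hg n).f i)) _
  have h := shiftLeftOrthogonal_of_isColimit_cofan hc hA
  exact (shiftLeftOrthogonal F).ext_of_isTriangulatedClosed₃ _ (triangleOfSES_distinguished hS) h h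

lemma shiftLeftOrthogonal_of_isStrictlyLE (P : CochainComplex (ModuleCat.{0} R) ℤ)
    [P.IsStrictlyLE 0]
    (h : ∀ i, shiftLeftOrthogonal F ((singleFunctor _ 0).obj (P.X i))) :
    shiftLeftOrthogonal F (Q.obj P) := by
  have key (n : ℕ) : shiftLeftOrthogonal F (Q.obj (ModuleCat.stupidTruncGE P (1 - n))) := by
    induction n with
    | zero =>
      have : IsZero (ModuleCat.stupidTruncGE P (1 - (0 : ℕ))) := by
        rw [IsZero.iff_id_eq_zero]
        ext i : 1
        refine (ModuleCat.isZero_stupidTruncGE_X P ?_).eq_of_src _ _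
        by_cases hi : i ≤ 0
        · exact .inl (by simp; lia)
        · exact .inr (P.isZero_of_isStrictlyLE 0 i)
      exact ObjectProperty.prop_of_isZero _ (Q.map_isZero this)
    | succ n ih =>
      have := ModuleCat.shortExact_stupidTruncGE P (1 - (n + 1 : ℕ))
      refine (shiftLeftOrthogonal F).ext_of_isTriangulatedClosed₂ _
        (triangleOfSES_distinguished this) ?_ (shiftLeftOrthogonal_singleFunctor (h _) _)
      change shiftLeftOrthogonal F (Q.obj (ModuleCat.stupidTruncGE P (1 - (n + 1 : ℕ) + 1)))
      rwa [show (1 - (n + 1 : ℕ) + 1 : ℤ) = 1 - n by lia]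
  refine shiftLeftOrthogonal_of_telescope
    (fun n ↦ ModuleCat.stupidTruncGEMap P (p := 1 - (n + 1 : ℕ)) (q := 1 - n) (by lia))
    (fun n ↦ ModuleCat.ιStupidTruncGE P _)
    (fun n ↦ rfl) (fun n i ↦ Submodule.subtype_injective _) (fun i m ↦ ?_) key
  refine ⟨(1 - i).toNat, ⟨m, ?_⟩, rfl⟩
  rw [if_pos (by lia)]
  trivial

end DerivedCategory

/-- A module which is killed by the kernel of a surjective ring homomorphism comes by restriction of
scalars from a module over the target. -/
lemma ModuleCat.exists_iso_restrictScalars {R S : Type} [Ring R] [Ring S] {φ : R →+* S}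
    (hφ : Function.Surjective φ)
    (M : ModuleCat.{0} R) (hM : ∀ r ∈ RingHom.ker φ, ∀ x : M, r • x = 0) :
    ∃ N : ModuleCat.{0} S, Nonempty ((ModuleCat.restrictScalars φ).obj N ≅ M) := by
  let σ := Function.surjInv hφ
  have hσ (s) : φ (σ s) = s := Function.surjInv_eq hφ s
  have key {a b : R} (h : φ a = φ b) (x : M) : a • x = b • x := by
    rw [← sub_eq_zero, ← sub_smul]
    exact hM _ (by simp [RingHom.mem_ker, h]) x
  let : Module S M :=
    { smul s x := σ s • x
      one_smul x := (key (by simp [hσ]) x).trans (one_smul R x)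
      mul_smul a b x := (key (by simp [hσ]) x).trans (mul_smul (σ a) (σ b) x)
      smul_zero a := smul_zero (σ a)
      smul_add a := smul_add (σ a)
      add_smul a b x := (key (by simp [hσ]) x).trans (add_smul (σ a) (σ b) x)
      zero_smul x := (key (by simp [hσ]) x).trans (zero_smul R x) }
  let f : (ModuleCat.restrictScalars φ).obj (ModuleCat.of S M) ⟶ M := ModuleCat.ofHom
    (X := (ModuleCat.restrictScalars φ).obj (ModuleCat.of S M))
    { toFun x := x
      map_add' _ _ := rfl
      map_smul' r x := key (hσ (φ r)) x }
  have : IsIso f := (ConcreteCategory.isIso_iff_bijective f).2 Function.bijective_id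
  exact ⟨ModuleCat.of S M, ⟨asIso f⟩⟩

namespace DerivedCategory

section
variable {R S : Type} [Ring R] [Ring S] [HasDerivedCategory.{w} (ModuleCat.{0} R)]
  {F : DerivedCategory (ModuleCat.{0} R)} {φ : R →+* S}

lemma shiftLeftOrthogonal_restrictScalars_of_projective
    (h : shiftLeftOrthogonal F ((singleFunctor _ 0).obj
      ((ModuleCat.restrictScalars φ).obj (ModuleCat.of S S)))) (N : ModuleCat.{0} S)
    [Projective N] :
    shiftLeftOrthogonal F ((singleFunctor _ 0).obj ((ModuleCat.restrictScalars φ).obj N)) := by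
  let p : (∐ fun _ : N ↦ ModuleCat.of S S) ⟶ N :=
    Sigma.desc fun x ↦ ModuleCat.ofHom (LinearMap.toSpanSingleton S N x)
  have : Epi p := by
    rw [ModuleCat.epi_iff_surjective]
    intro x
    refine ⟨Sigma.ι (fun _ : N ↦ ModuleCat.of S S) x (1 : S), ?_⟩
    have := congr($(Sigma.ι_desc (fun x : N ↦ ModuleCat.ofHom (LinearMap.toSpanSingleton S N x)) x)
      (1 : S))
    exact this.trans (one_smul S x)
  have r : Retract N (∐ fun _ : N ↦ ModuleCat.of S S) :=
    { i := Projective.factorThru (𝟙 N) p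
      r := p
      retract := Projective.factorThru_comp _ _ }
  refine shiftLeftOrthogonal_of_retract (r.map (ModuleCat.restrictScalars φ ⋙ singleFunctor _ 0)) ?_
  refine (shiftLeftOrthogonal F).prop_of_iso ((singleFunctorIsoCompQ _ 0).symm.app _) ?_
  exact shiftLeftOrthogonal_of_isColimit_cofan (isColimitCofanMkObjOfIsColimit
    (ModuleCat.restrictScalars φ ⋙ HomologicalComplex.single _ (.up ℤ) 0) _ _
    (coproductIsCoproduct fun _ : N ↦ ModuleCat.of S S))
    fun _ ↦ shiftLeftOrthogonal_singleFunctor h 0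

lemma shiftLeftOrthogonal_restrictScalars
    (h : shiftLeftOrthogonal F ((singleFunctor _ 0).obj
      ((ModuleCat.restrictScalars φ).obj (ModuleCat.of S S)))) (N : ModuleCat.{0} S) :
    shiftLeftOrthogonal F ((singleFunctor _ 0).obj ((ModuleCat.restrictScalars φ).obj N)) := by
  let G := (ModuleCat.restrictScalars.{0} φ).mapHomologicalComplex (.up ℤ)
  let P := projectiveResolution N
  have : CochainComplex.IsStrictlyLE (G.obj P.cochainComplex) 0 := by
    rw [CochainComplex.isStrictlyLE_iff]
    intro i hi
    exact (ModuleCat.restrictScalars φ).map_isZero (CochainComplex.isZero_of_isStrictlyLE _ 0 _)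
  have hP : shiftLeftOrthogonal F (Q.obj (G.obj P.cochainComplex)) :=
    shiftLeftOrthogonal_of_isStrictlyLE _ fun i ↦
      shiftLeftOrthogonal_restrictScalars_of_projective h (P.cochainComplex.X i)
  have : QuasiIso (G.map P.π') := by
    have := (ModuleCat.restrictScalars.{0} φ).preservesHomology_of_preservesEpis_and_kernels
    dsimp only [G]
    infer_instance
  have : IsIso (Q.map (G.map P.π')) := (isIso_Q_map_iff_quasiIso _ _).2 this
  refine (shiftLeftOrthogonal F).prop_of_iso ?_ hP
  exact asIso (Q.map (G.map P.π')) ≪≫ Q.mapIso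
    ((HomologicalComplex.singleMapHomologicalComplex (ModuleCat.restrictScalars φ) (.up ℤ) 0).app N)
    ≪≫ (singleFunctorIsoCompQ _ 0).symm.app _

end

end DerivedCategory

end DerivedCategoryLemmas

/-- Let `k` be a field and `φ : R → S` a surjective homomorphism of
smooth commutative `k`-algebras, with kernel `I`; view `S` as an `R`-module via `φ`.
Let `F` be an object of the (unbounded) derived category of `R`-modules whose
cohomology modules are locally annihilated by powers of `I`.  If
`Hom_{D(R)}(S, F⟦n⟧) = 0` for every integer `n`, then `F ≅ 0`. -/
theorem isZero_of_hom_from_quotient_eq_zero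
    {k R S : Type} [Field k] [CommRing R] [CommRing S] [Algebra k R] [Algebra k S]
    [Algebra.Smooth k R] [Algebra.Smooth k S]
    (φ : R →ₐ[k] S) (hφ : Function.Surjective φ)
    [HasDerivedCategory (ModuleCat R)]
    (F : DerivedCategory (ModuleCat R))
    (htors : ∀ (n : ℤ) (x : (DerivedCategory.homologyFunctor (ModuleCat R) n).obj F),
      ∃ m : ℕ, ∀ r ∈ (RingHom.ker φ) ^ m, r • x = 0)
    (hvanish : ∀ (n : ℤ)
      (f : (DerivedCategory.singleFunctor (ModuleCat R) 0).obj
          (restrictedModule (φ : R →+* S)) ⟶ F⟦n⟧), f = 0) :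
    Limits.IsZero F := by
  have : IsNoetherianRing R := Algebra.FiniteType.isNoetherianRing k R
  obtain ⟨s, hs⟩ := IsNoetherian.noetherian (RingHom.ker φ)
  refine DerivedCategory.isZero_of_shiftLeftOrthogonal_of_torsion s (fun r hr n x ↦ ?_)
    fun M hM ↦ ?_
  · obtain ⟨m, hm⟩ := htors n x
    exact ⟨m, hm _ (Ideal.pow_mem_pow (hs ▸ Submodule.subset_span hr) m)⟩
  · obtain ⟨N, ⟨e⟩⟩ := ModuleCat.exists_iso_restrictScalars (φ := (φ : R →+* S)) hφ M
      fun r hr x ↦ by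
        have hr : r ∈ Submodule.span R (s : Set R) := hs ▸ hr
        have h : Submodule.span R (s : Set R) ≤ Module.annihilator R M :=
          Submodule.span_le.2 fun r hr ↦ Module.mem_annihilator.2 fun x ↦ congr($(hM r hr) x)
        exact Module.mem_annihilator.1 (h hr) x
    exact (DerivedCategory.shiftLeftOrthogonal F).prop_of_iso
      ((DerivedCategory.singleFunctor _ 0).mapIso e)
      (DerivedCategory.shiftLeftOrthogonal_restrictScalars
        ((DerivedCategory.shiftLeftOrthogonal_iff _ _).2 hvanish) N)
end
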